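/- Let H ≤ S_n be semiregular with orbit transversal R, and let G ≤ N_{S_n}(H) ∩ Stab_{S_n}(R). Let h ∈ H, g ∈ G, let ρ be a nonempty finite word over {1,…,n} with last letter r, and let s = hg. Then A_{id}^{-1} ∘ [ρ]_s ∘ A_{id} (first A_{id}^{-1}, then [ρ]_s, then A_{id}) equals the composite, in left-to-right action order, of ⌊ρ·A_{id}⌋_{h_r^{-1}·h·h_{r·g^{-1}}} followed by [ρ·A_{id}]_g; in particular this conjugate lies in V_n(G). -/

import Mathlib

open scoped Classical Pointwise

/-- The group of self-homeomorphisms of a topological space, with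
`(f * g) x = f (g x)`. -/
instance homeoGroup (X : Type*) [TopologicalSpace X] : Group (X ≃ₜ X) where
  mul a b := b.trans a
  one := Homeomorph.refl X
  inv := Homeomorph.symm
  mul_assoc a b c := Homeomorph.ext fun _ => rfl
  one_mul a := Homeomorph.ext fun _ => rfl
  mul_one a := Homeomorph.ext fun _ => rfl
  inv_mul_cancel a := Homeomorph.ext fun x => a.symm_apply_apply x

/-- The `n`-ary Cantor space: infinite sequences over an `n`-letter alphabet. -/
abbrev Cantor (n : ℕ) := ℕ → Fin n

/-- Prefix a sequence by a finite word. -/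
def appendWord {n : ℕ} (θ : List (Fin n)) (x : Cantor n) : Cantor n :=
  fun i => if h : i < θ.length then θ.get ⟨i, h⟩ else x (i - θ.length)

/-- `x` lies in the cone `[θ]`, i.e. has `θ` as a prefix. -/
def inCone {n : ℕ} (θ : List (Fin n)) (x : Cantor n) : Prop :=
  ∀ i, (h : i < θ.length) → x i = θ.get ⟨i, h⟩

/-- A map is a prefix-substitution map if it is given by two partitions of the
Cantor space into cones `[α i]` resp. `[β i]`, replacing the prefix `α i` by `β i`. -/
def IsPrefixMap {n : ℕ} (v : Cantor n → Cantor n) : Prop :=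
  ∃ (t : ℕ) (α β : Fin t → List (Fin n)),
    (∀ x : Cantor n, ∃! i, inCone (α i) x) ∧
    (∀ x : Cantor n, ∃! i, inCone (β i) x) ∧
    ∀ (i : Fin t) (γ : Cantor n), v (appendWord (α i) γ) = appendWord (β i) γ

/-- The Higman–Thompson group `V_n`, as a subgroup of the homeomorphism group of
the `n`-ary Cantor space: the group of all prefix-substitution homeomorphisms. -/
def HigmanThompson (n : ℕ) : Subgroup (Cantor n ≃ₜ Cantor n) :=
  Subgroup.closure {v | IsPrefixMap ⇑v}

/-- The iterated permutation `[α]_g` (as a function): identity outside the cone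
`[α]`, and applying `g` to every letter after the prefix `α` inside it.
With `α = []` this is `[∅]_g`, applying `g` to every letter. -/
noncomputable def iterPermFun {n : ℕ} (α : List (Fin n)) (g : Equiv.Perm (Fin n))
    (x : Cantor n) : Cantor n :=
  if inCone α x then fun i => if i < α.length then x i else g (x i) else x

/-- The group `V_n(G)`: the subgroup of the homeomorphism group of the `n`-ary
Cantor space generated by `V_n` together with all iterated permutations `[α]_g`
for `g ∈ G` and finite words `α`. -/
def VnG (n : ℕ) (G : Subgroup (Equiv.Perm (Fin n))) : Subgroup (Cantor n ≃ₜ Cantor n) :=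
  Subgroup.closure
    ({v | IsPrefixMap ⇑v} ∪
      {v | ∃ (α : List (Fin n)) (g : Equiv.Perm (Fin n)), g ∈ G ∧ ⇑v = iterPermFun α g})

/-- A permutation group is semiregular if no nontrivial element has a fixed point. -/
def Semiregular {n : ℕ} (G : Subgroup (Equiv.Perm (Fin n))) : Prop :=
  ∀ g ∈ G, (∃ x, g x = x) → g = 1

/-- `R` is an orbit transversal for the natural action of `H ≤ S_n` on the `n`
points: it contains exactly one point of each `H`-orbit. -/
def IsTransversal {n : ℕ} (H : Subgroup (Equiv.Perm (Fin n))) (R : Set (Fin n)) : Prop :=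
  ∀ x : Fin n, ∃! r, r ∈ R ∧ ∃ h ∈ H, h x = r

/-- `hmap` assigns to each letter `i` the (unique) element `h_i` of `H` with
`i ⬝ h_i ∈ R`. -/
def IsHmap {n : ℕ} (H : Subgroup (Equiv.Perm (Fin n))) (R : Set (Fin n))
    (hmap : Fin n → Equiv.Perm (Fin n)) : Prop :=
  ∀ i : Fin n, hmap i ∈ H ∧ hmap i i ∈ R

/-- The transducer map `A_h` on the Cantor space: the first letter is moved by
`h`, and each subsequent letter `x_{k+1}` is moved by `h_{x_k}` (here `hmap i`
plays the role of `h_i`). -/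
def AFun {n : ℕ} (h : Equiv.Perm (Fin n)) (hmap : Fin n → Equiv.Perm (Fin n))
    (x : Cantor n) : Cantor n
  | 0 => h (x 0)
  | k + 1 => hmap (x k) (x (k + 1))

/-- The recursively defined inverse of the transducer map `A_h`: the first
letter of `B χ` is `χ_1 ⬝ h⁻¹`, and its `(k+1)`-st letter is
`χ_{k+1} ⬝ (h_{y_k})⁻¹` where `y_k` is the `k`-th letter of `B χ`. -/
def BFun {n : ℕ} (h : Equiv.Perm (Fin n)) (hmap : Fin n → Equiv.Perm (Fin n))
    (x : Cantor n) : ℕ → Fin n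
  | 0 => h⁻¹ (x 0)
  | k + 1 => (hmap (BFun h hmap x k))⁻¹ (x (k + 1))

/-- Auxiliary: image under the transducer `A_id` of a finite word continuing
from the previous letter `prev`. -/
def wordAAux {n : ℕ} (hmap : Fin n → Equiv.Perm (Fin n)) (prev : Fin n) :
    List (Fin n) → List (Fin n)
  | [] => []
  | b :: bs => hmap prev b :: wordAAux hmap b bs

/-- The image `ρ ⬝ A_id` of a finite word `ρ = r₁r₂…r_k` under the transducer
`A_id`: the first letter is `r₁` and the `(j+1)`-st letter is `r_{j+1} ⬝ h_{r_j}`. -/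
def wordA {n : ℕ} (hmap : Fin n → Equiv.Perm (Fin n)) : List (Fin n) → List (Fin n)
  | [] => []
  | a :: rest => a :: wordAAux hmap a rest

/-- `⌊α⌋_s` (as a function): maps `α i γ` to `α (i ⬝ s) γ`, i.e. permutes by `s`
the letter immediately following the prefix `α`, and is the identity outside the
cone `[α]`. -/
noncomputable def floorFun {n : ℕ} (α : List (Fin n)) (s : Equiv.Perm (Fin n))
    (x : Cantor n) : Cantor n :=
  if inCone α x then fun i => if i = α.length then s (x i) else x i else x

theorem inCone_ofFn {n N : ℕ} (u : Fin N → Fin n) (x : Cantor n) :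
    inCone (List.ofFn u) x ↔ ∀ i : Fin N, x i = u i := by
  constructor
  · intro hx i
    have := hx i (by simp)
    simpa using this
  · intro hx i hi
    have := hx ⟨i, by simpa using hi⟩
    simpa using this

theorem isPrefixMap_of_local {n : ℕ} [NeZero n] (N : ℕ) (f f' : Cantor n → Cantor n)
    (hff : ∀ x, f (f' x) = x) (hff' : ∀ x, f' (f x) = x)
    (h1 : ∀ x i, N ≤ i → f x i = x i)
    (h2 : ∀ x y, (∀ i < N, x i = y i) → ∀ i < N, f x i = f y i)
    (h2' : ∀ x y, (∀ i < N, x i = y i) → ∀ i < N, f' x i = f' y i) :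
    IsPrefixMap f := by
  let e := (Fintype.equivFin (Fin N → Fin n)).symm
  let ex : (Fin N → Fin n) → Cantor n := fun u j => if hj : j < N then u ⟨j, hj⟩ else 0
  have hex : ∀ u (i : ℕ) (hi : i < N), ex u i = u ⟨i, hi⟩ := fun u i hi => by simp [ex, hi]
  refine ⟨_, fun k => List.ofFn (e k), fun k => List.ofFn (fun i : Fin N => f (ex (e k)) i),
    ?_, ?_, ?_⟩
  · intro x
    refine ⟨e.symm (fun i => x i), ?_, ?_⟩
    · simp [inCone_ofFn]
    · intro k hk
      simp only [inCone_ofFn] at hk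
      rw [Equiv.eq_symm_apply]
      funext i
      exact (hk i).symm
  · intro x
    refine ⟨e.symm (fun i => f' x i), ?_, ?_⟩
    · simp only [inCone_ofFn, Equiv.apply_symm_apply]
      intro i
      have := h2 (ex fun i => f' x i) (f' x)
        (fun i hi => hex (fun i => f' x i) i hi) i i.2
      rw [this, hff]
    · intro k hk
      simp only [inCone_ofFn] at hk
      rw [Equiv.eq_symm_apply]
      funext i
      have := h2' x (f (ex (e k))) (fun j hj => hk ⟨j, hj⟩) i i.2
      rw [hff', hex _ _ i.2] at this
      exact this.symm
  · intro k γ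
    funext j
    by_cases hj : j < N
    · have := h2 (appendWord (List.ofFn (e k)) γ) (ex (e k))
        (fun i hi => by rw [hex _ _ hi]; simp [appendWord, hi]) j hj
      rw [this]
      simp [appendWord, hj]
    · rw [h1 _ _ (not_lt.mp hj)]
      simp [appendWord, hj]

theorem inCone_floorFun {n : ℕ} (α : List (Fin n)) (s : Equiv.Perm (Fin n)) (x : Cantor n) :
    inCone α (floorFun α s x) ↔ inCone α x := by
  unfold floorFun
  split_ifs with hx
  · refine ⟨fun _ => hx, fun _ i hi => ?_⟩
    rw [← hx i hi]
    exact if_neg hi.ne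
  · rfl

theorem floorFun_inv {n : ℕ} (α : List (Fin n)) (s t : Equiv.Perm (Fin n)) (hst : s * t = 1)
    (x : Cantor n) : floorFun α s (floorFun α t x) = x := by
  have hst' : ∀ a, s (t a) = a := fun a => by rw [← Equiv.Perm.mul_apply, hst]; rfl
  by_cases hx : inCone α x
  · have hx' := (inCone_floorFun α t x).2 hx
    rw [floorFun, if_pos hx', floorFun, if_pos hx]
    funext i
    by_cases hi : i = α.length <;> simp [hi, hst']
  · have hx' := mt (inCone_floorFun α t x).1 hx
    rw [floorFun, if_neg hx', floorFun, if_neg hx]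

theorem floorFun_local {n : ℕ} (α : List (Fin n)) (s : Equiv.Perm (Fin n)) (x y : Cantor n)
    (hxy : ∀ i < α.length + 1, x i = y i) (i : ℕ) (hi : i < α.length + 1) :
    floorFun α s x i = floorFun α s y i := by
  have hc : inCone α x ↔ inCone α y := by
    unfold inCone
    constructor
    · intro h i hi; rw [← hxy i (by omega)]; exact h i hi
    · intro h i hi; rw [hxy i (by omega)]; exact h i hi
  unfold floorFun
  by_cases hx : inCone α x
  · rw [if_pos hx, if_pos (hc.1 hx)]
    simp [hxy i hi]
  · rw [if_neg hx, if_neg (mt hc.2 hx), hxy i hi]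

theorem isClopen_cone {n : ℕ} (α : List (Fin n)) : IsClopen {x : Cantor n | inCone α x} := by
  have : {x : Cantor n | inCone α x}
      = ⋂ i : Fin α.length, (fun x : Cantor n => x i) ⁻¹' {α.get i} := by
    ext x
    simp only [Set.mem_ofPred_eq, Set.mem_iInter, Set.mem_preimage, Set.mem_singleton_iff]
    exact ⟨fun h i => h i i.2, fun h i hi => h ⟨i, hi⟩⟩
  rw [this]
  exact isClopen_iInter_of_finite fun i => (isClopen_discrete _).preimage (continuous_apply _)

theorem continuous_floorFun {n : ℕ} (α : List (Fin n)) (s : Equiv.Perm (Fin n)) :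
    Continuous (floorFun α s) := by
  unfold floorFun
  refine Continuous.if ?_ ?_ continuous_id
  · intro a ha
    rw [(isClopen_cone α).frontier_eq] at ha
    exact ha.elim
  · refine continuous_pi fun i => ?_
    by_cases hi : i = α.length
    · simp only [hi, if_true]
      exact (continuous_of_discreteTopology (f := s)).comp (continuous_apply _)
    · simp only [hi, if_false]
      exact continuous_apply _

/-- The homeomorphism with underlying map `floorFun α s`. -/
noncomputable def floorHomeo {n : ℕ} (α : List (Fin n)) (s : Equiv.Perm (Fin n)) :
    Cantor n ≃ₜ Cantor n where
  toFun := floorFun α s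
  invFun := floorFun α s⁻¹
  left_inv := floorFun_inv α s⁻¹ s (by simp)
  right_inv := floorFun_inv α s s⁻¹ (by simp)
  continuous_toFun := continuous_floorFun α s
  continuous_invFun := continuous_floorFun α s⁻¹

theorem isPrefixMap_floorFun {n : ℕ} [NeZero n] (α : List (Fin n)) (s : Equiv.Perm (Fin n)) :
    IsPrefixMap (floorFun α s) := by
  refine isPrefixMap_of_local (α.length + 1) _ (floorFun α s⁻¹)
    (floorFun_inv α s s⁻¹ (by simp)) (floorFun_inv α s⁻¹ s (by simp)) ?_
    (floorFun_local α s) (floorFun_local α s⁻¹)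
  intro x i hi
  unfold floorFun
  split_ifs
  · exact if_neg (by omega)
  · rfl

theorem length_wordAAux {n : ℕ} (hmap : Fin n → Equiv.Perm (Fin n)) (l : List (Fin n)) :
    ∀ p, (wordAAux hmap p l).length = l.length := by
  induction l with
  | nil => intro p; rfl
  | cons b bs ih => intro p; simp [wordAAux, ih]

theorem length_wordA {n : ℕ} (hmap : Fin n → Equiv.Perm (Fin n)) (l : List (Fin n)) :
    (wordA hmap l).length = l.length := by
  cases l with
  | nil => rfl
  | cons b bs => simp [wordA, length_wordAAux]

theorem getElem_wordAAux {n : ℕ} (hmap : Fin n → Equiv.Perm (Fin n)) (l : List (Fin n)) :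
    ∀ (p : Fin n) (i : ℕ) (hi : i < l.length) (hi' : i < (wordAAux hmap p l).length),
      (wordAAux hmap p l)[i] = hmap ((p :: l)[i]'(by simp; omega)) l[i] := by
  induction l with
  | nil => intro p i hi; simp at hi
  | cons b bs ih =>
    intro p i hi hi'
    cases i with
    | zero => simp [wordAAux]
    | succ j =>
      have := ih b j (by simpa using hi) (by rw [length_wordAAux]; simpa using hi)
      simpa [wordAAux] using this

theorem getElem_wordA_zero {n : ℕ} (hmap : Fin n → Equiv.Perm (Fin n)) (l : List (Fin n))
    (h0 : 0 < l.length) (h0' : 0 < (wordA hmap l).length) : (wordA hmap l)[0] = l[0] := by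
  cases l with
  | nil => simp at h0
  | cons b bs => simp [wordA]

theorem getElem_wordA_succ {n : ℕ} (hmap : Fin n → Equiv.Perm (Fin n)) (l : List (Fin n))
    (i : ℕ) (hi : i + 1 < l.length) (hi' : i + 1 < (wordA hmap l).length) :
    (wordA hmap l)[i + 1] = hmap l[i] l[i + 1] := by
  cases l with
  | nil => simp at hi
  | cons b bs =>
    have := getElem_wordAAux hmap bs b i (by simpa using hi)
      (by rw [length_wordAAux]; simpa using hi)
    simpa [wordA] using this

theorem AFun_BFun {n : ℕ} (hmap : Fin n → Equiv.Perm (Fin n)) (x : Cantor n) :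
    AFun 1 hmap (BFun 1 hmap x) = x := by
  funext i
  cases i <;> simp [AFun, BFun]

theorem inCone_BFun {n : ℕ} (hmap : Fin n → Equiv.Perm (Fin n)) (ρ : List (Fin n))
    (x : Cantor n) : inCone ρ (BFun 1 hmap x) ↔ inCone (wordA hmap ρ) x := by
  constructor
  · intro hy i hi
    have hi' := hi
    rw [length_wordA] at hi'
    rw [← AFun_BFun hmap x]
    simp only [List.get_eq_getElem]
    cases i with
    | zero =>
      rw [getElem_wordA_zero hmap ρ hi']
      simpa [AFun] using hy 0 hi'
    | succ j =>
      rw [getElem_wordA_succ hmap ρ j hi']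
      have e1 := hy j (by omega)
      have e2 := hy (j + 1) hi'
      simp only [List.get_eq_getElem] at e1 e2
      rw [AFun, e1, e2]
  · intro hx i
    induction i with
    | zero =>
      intro hi
      have e := hx 0 (by rwa [length_wordA])
      simp only [List.get_eq_getElem] at e
      rw [getElem_wordA_zero hmap ρ hi] at e
      simpa [BFun] using e
    | succ j ih =>
      intro hi
      have e := hx (j + 1) (by rwa [length_wordA])
      have e1 := ih (by omega)
      simp only [List.get_eq_getElem] at e e1
      rw [getElem_wordA_succ hmap ρ j hi] at e
      simp [BFun, e, e1]

theorem hmap_unique {n : ℕ} {H : Subgroup (Equiv.Perm (Fin n))} (hH : Semiregular H)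
    {R : Set (Fin n)} (hR : IsTransversal H R) {hmap : Fin n → Equiv.Perm (Fin n)}
    (hhmap : IsHmap H R hmap) (i : Fin n) (a : Equiv.Perm (Fin n)) (ha : a ∈ H)
    (haR : a i ∈ R) : hmap i = a := by
  obtain ⟨hi, hiR⟩ := hhmap i
  have e : hmap i i = a i := (hR i).unique ⟨hiR, _, hi, rfl⟩ ⟨haR, _, ha, rfl⟩
  have := hH (a⁻¹ * hmap i) (H.mul_mem (H.inv_mem ha) hi) ⟨i, by simp [e]⟩
  exact (inv_mul_eq_one.1 this).symm

/-- Let `H ≤ S_n` be semiregular with orbit transversal `R`,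
`G ≤ N_{S_n}(H) ⊓ Stab_{S_n}(R)`, `h ∈ H`, `g ∈ G`, `ρ` a nonempty word with
last letter `r`, and `s = hg` (apply `h` then `g`, i.e. `g * h`).  Then
`A_id⁻¹ ∘ [ρ]_s ∘ A_id` equals `⌊ρ⬝A_id⌋_{h_r⁻¹ ⬝ h ⬝ h_{r⬝g⁻¹}}` followed by
`[ρ⬝A_id]_g` (the left-to-right product `h_r⁻¹ ⬝ h ⬝ h_{r⬝g⁻¹}` is
`hmap (g⁻¹ r) * h * (hmap r)⁻¹` in Mathlib's convention); in particular any
homeomorphism with this underlying map lies in `V_n(G)`. -/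
theorem conj_iterated_permutation (n : ℕ) (hn : 2 ≤ n)
    (H : Subgroup (Equiv.Perm (Fin n))) (hH : Semiregular H)
    (R : Set (Fin n)) (hR : IsTransversal H R)
    (G : Subgroup (Equiv.Perm (Fin n)))
    (hG : G ≤ Subgroup.normalizer (H : Set (Equiv.Perm (Fin n))) ⊓ MulAction.stabilizer (Equiv.Perm (Fin n)) R)
    (hmap : Fin n → Equiv.Perm (Fin n)) (hhmap : IsHmap H R hmap)
    (h g : Equiv.Perm (Fin n)) (hh : h ∈ H) (hg : g ∈ G)
    (ρ : List (Fin n)) (hne : ρ ≠ []) (r : Fin n) (hr : r = ρ.getLast hne) :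
    (∀ x : Cantor n,
        AFun 1 hmap (iterPermFun ρ (g * h) (BFun 1 hmap x))
          = iterPermFun (wordA hmap ρ) g
              (floorFun (wordA hmap ρ) (hmap (g⁻¹ r) * h * (hmap r)⁻¹) x)) ∧
      ∀ w : Cantor n ≃ₜ Cantor n,
        (⇑w = fun x => AFun 1 hmap (iterPermFun ρ (g * h) (BFun 1 hmap x))) →
          w ∈ VnG n G := by
  have key1 : ∀ j, hmap (h j) * h = hmap j := fun j =>
    (hmap_unique hH hR hhmap j _ (H.mul_mem (hhmap _).1 hh) (hhmap (h j)).2).symm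
  have key2 : ∀ j, hmap (g j) * g = g * hmap j := by
    intro j
    obtain ⟨hgN, hgR⟩ := hG hg
    have e : hmap (g j) = g * hmap j * g⁻¹ := by
      refine hmap_unique hH hR hhmap _ _ ?_ ?_
      · exact (Subgroup.mem_normalizer_iff.1 hgN _).1 (hhmap j).1
      · have := (hhmap j).2
        have hgR' : g • R = R := hgR
        rw [← hgR']
        exact ⟨hmap j j, this, by simp⟩
    rw [e]; group
  have key3 : ∀ j k, hmap (g (h j)) (g (h k)) = g (hmap j k) := by
    intro j k
    have e2 := congrArg (fun p : Equiv.Perm (Fin n) => p (h k)) (key2 (h j))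
    have e1 := congrArg (fun p : Equiv.Perm (Fin n) => p k) (key1 j)
    simp only [Equiv.Perm.mul_apply] at e1 e2
    rw [e2, e1]
  have main : ∀ x : Cantor n,
        AFun 1 hmap (iterPermFun ρ (g * h) (BFun 1 hmap x))
          = iterPermFun (wordA hmap ρ) g
              (floorFun (wordA hmap ρ) (hmap (g⁻¹ r) * h * (hmap r)⁻¹) x) := by
    intro x
    by_cases hx : inCone (wordA hmap ρ) x
    · have hy := (inCone_BFun hmap ρ x).2 hx
      rw [iterPermFun, if_pos hy, iterPermFun, if_pos ((inCone_floorFun _ _ _).2 hx), floorFun,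
        if_pos hx, length_wordA]
      have hlen : 0 < ρ.length := List.length_pos_iff.2 hne
      funext i
      cases i with
      | zero => simp [AFun, hlen, hlen.ne, BFun]
      | succ j =>
        rcases lt_trichotomy (j + 1) ρ.length with hj | hj | hj
        · have hj' : j < ρ.length := by omega
          simp [AFun, hj, hj', hj.ne, BFun]
        · have hj' : j < ρ.length := by omega
          have hyr : BFun 1 hmap x j = r := by
            rw [hy j hj', hr, List.getLast_eq_getElem]
            simp [← hj]
          have e2 := key2 (g⁻¹ r)
          have e3 := congrArg (fun p : Equiv.Perm (Fin n) => p (h ((hmap r)⁻¹ (x (j + 1))))) e2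
          simp only [Equiv.Perm.mul_apply] at e3
          rw [show g (g⁻¹ r) = r from g.apply_symm_apply r] at e3
          simp only [AFun, hj', hj, lt_irrefl, if_true, if_false, Equiv.Perm.mul_apply]
          rw [← hj, BFun, hyr]
          exact e3
        · have hj1 : ¬ (j + 1 < ρ.length) := by omega
          have hj2 : ¬ (j < ρ.length) := by omega
          simp only [AFun, hj1, hj2, hj.ne', if_false, Equiv.Perm.mul_apply]
          rw [key3]
          simp [BFun]
    · have hy := mt (inCone_BFun hmap ρ x).1 hx
      rw [iterPermFun, if_neg hy, iterPermFun, if_neg (mt (inCone_floorFun _ _ _).1 hx), floorFun,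
        if_neg hx, AFun_BFun]
  refine ⟨main, fun w hw => ?_⟩
  have : NeZero n := ⟨by omega⟩
  set s := hmap (g⁻¹ r) * h * (hmap r)⁻¹ with hs
  set F := floorHomeo (wordA hmap ρ) s with hF
  have hFm : F ∈ VnG n G := Subgroup.subset_closure (Or.inl (isPrefixMap_floorFun _ _))
  have hI : w * F⁻¹ ∈ VnG n G := by
    refine Subgroup.subset_closure (Or.inr ⟨wordA hmap ρ, g, hg, ?_⟩)
    funext x
    change w (F.symm x) = _
    rw [hw]
    change AFun 1 hmap (iterPermFun ρ (g * h) (BFun 1 hmap (F.symm x))) = _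
    rw [main]
    exact congrArg _ (F.apply_symm_apply x)
  have := (VnG n G).mul_mem hI hFm
  rwa [inv_mul_cancel_right] at this
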